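/- If G is a connected, leafless, non–self-embeddable graph, then its subdivision graph S(G) is also connected, leafless, and non–self-embeddable; moreover, S(G) contains no 4-cycle. -/

import Mathlib

open SimpleGraph

universe u v w x

/-- A monochromatic copy: `col = true` means red, `col = false` means blue.
There is a copy of `G` in `F` all of whose edges get color `col` under `c`. -/
def HasMonoCopy {α β : Type*} (F : SimpleGraph α) (c : Sym2 α → Bool) (col : Bool)
    (G : SimpleGraph β) : Prop :=
  ∃ f : β → α, Function.Injective f ∧
    ∀ ⦃x y⦄, G.Adj x y → F.Adj (f x) (f y) ∧ c s(f x, f y) = col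

/-- `F → (G,H)`: every red-blue edge coloring of `F` yields a red `G` or a blue `H`. -/
def Arrows {α β γ : Type*} (F : SimpleGraph α) (G : SimpleGraph β) (H : SimpleGraph γ) : Prop :=
  ∀ c : Sym2 α → Bool, HasMonoCopy F c true G ∨ HasMonoCopy F c false H

/-- A `(G,H)`-good coloring of `F`: neither a red copy of `G` nor a blue copy of `H`. -/
def GoodColoring {α β γ : Type*} (F : SimpleGraph α) (G : SimpleGraph β) (H : SimpleGraph γ)
    (c : Sym2 α → Bool) : Prop :=
  ¬ HasMonoCopy F c true G ∧ ¬ HasMonoCopy F c false H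

/-- `F` is `(G,H)`-minimal: `F → (G,H)` but no proper subgraph of `F` arrows `(G,H)`. -/
def IsRamseyMinimal {α β γ : Type*} (F : SimpleGraph α) (G : SimpleGraph β)
    (H : SimpleGraph γ) : Prop :=
  Arrows F G H ∧ ∀ F' : F.Subgraph, F' ≠ ⊤ → ¬ Arrows F'.coe G H

/-- `G` embeds into `H` (as a, not necessarily induced, subgraph). -/
def Embeds {α β : Type*} (G : SimpleGraph α) (H : SimpleGraph β) : Prop :=
  ∃ f : α → β, Function.Injective f ∧ ∀ ⦃x y⦄, G.Adj x y → H.Adj (f x) (f y)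

/-- `G` is self-embeddable: it is isomorphic to a proper subgraph of itself. -/
def SelfEmbeddable {α : Type*} (G : SimpleGraph α) : Prop :=
  ∃ G' : G.Subgraph, G' ≠ ⊤ ∧ Nonempty (G ≃g G'.coe)

/-- A graph is leafless if no vertex has exactly one neighbor. -/
def Leafless {α : Type*} (G : SimpleGraph α) : Prop :=
  ∀ v : α, ¬ ∃! w, G.Adj v w

/-- `G` is a star `K_{1,κ}` (κ ≥ 1): a center adjacent to every other vertex,
every edge meets the center, and there is at least one other vertex. -/
def IsStar {α : Type*} (G : SimpleGraph α) : Prop :=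
  ∃ c : α, (∃ v, v ≠ c) ∧ (∀ v, v ≠ c → G.Adj c v) ∧ ∀ ⦃x y⦄, G.Adj x y → x = c ∨ y = c

/-- A star forest: every connected component is a star. -/
def IsStarForest {α : Type*} (G : SimpleGraph α) : Prop :=
  ∀ C : G.ConnectedComponent, IsStar (G.induce C.supp)

/-- The star `S_n` with `n` edges: center `none`, leaves `some i`. -/
def starGraph (n : ℕ) : SimpleGraph (Option (Fin n)) :=
  SimpleGraph.fromRel fun a b => a = none ∨ b = none

/-- Disjoint union of two graphs. -/
def sumGraph {α β : Type*} (G : SimpleGraph α) (H : SimpleGraph β) : SimpleGraph (α ⊕ β) :=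
  SimpleGraph.fromRel fun a b =>
    match a, b with
    | Sum.inl a, Sum.inl b => G.Adj a b
    | Sum.inr a, Sum.inr b => H.Adj a b
    | _, _ => False

/-- Disjoint union of a family of graphs. -/
def sigmaGraph {ι : Type*} {V : ι → Type*} (G : ∀ i, SimpleGraph (V i)) :
    SimpleGraph (Σ i, V i) :=
  SimpleGraph.fromRel fun a b => ∃ h : a.1 = b.1, (G b.1).Adj (h ▸ a.2) b.2

/-- The double ray (two-way infinite path). -/
def doubleRay : SimpleGraph ℤ := SimpleGraph.fromRel fun a b => b = a + 1

/-- The ray (one-way infinite path). -/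
def rayGraph : SimpleGraph ℕ := SimpleGraph.fromRel fun a b => b = a + 1

/-- `2S_1`: a matching with two edges. -/
def twoS1 : SimpleGraph (Fin 2 ⊕ Fin 2) :=
  sumGraph (⊤ : SimpleGraph (Fin 2)) (⊤ : SimpleGraph (Fin 2))

/-- `kℤ`: the disjoint union of `k` double rays. -/
def nZ (k : ℕ) : SimpleGraph (Σ _ : Fin k, ℤ) :=
  sigmaGraph fun _ : Fin k => doubleRay

/-- The 4-cycle. -/
def cycle4 : SimpleGraph (ZMod 4) := SimpleGraph.fromRel fun a b => b = a + 1

/-- The subdivision graph `S(G)`: each edge of `G` gets a new subdividing vertex. -/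
def subdivision {α : Type*} (G : SimpleGraph α) : SimpleGraph (α ⊕ G.edgeSet) :=
  SimpleGraph.fromRel fun a b =>
    match a, b with
    | Sum.inl v, Sum.inr e => v ∈ (e : Sym2 α)
    | _, _ => False

/-- The graph `Γ(K,A,n)`: to each `u ∈ A` of (finite) degree `m` we add `m·(n-1)` new
clones of `u`, each joined to precisely the neighbors of `u` in `K`. -/
def Gamma {α : Type*} (K : SimpleGraph α) (A : Set α) (n : ℕ) :
    SimpleGraph (α ⊕ Σ u : A, Fin ((K.neighborSet (u : α)).ncard * (n - 1))) :=
  SimpleGraph.fromRel fun a b =>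
    match a, b with
    | Sum.inl x, Sum.inl y => K.Adj x y
    | Sum.inl x, Sum.inr p => K.Adj (p.1 : α) x
    | _, _ => False

/-- The extension property of the Rado graph. -/
def ExtensionProperty {α : Type*} (R : SimpleGraph α) : Prop :=
  ∀ U W : Finset α, Disjoint U W →
    ∃ v, v ∉ U ∧ v ∉ W ∧ (∀ u ∈ U, R.Adj v u) ∧ ∀ w ∈ W, ¬ R.Adj v w

/-- The set of subdividing vertices of `S(G)`. -/
def subdividers {α : Type*} (G : SimpleGraph α) : Set (α ⊕ G.edgeSet) :=
  Set.range Sum.inr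

/-- Vertex type of `Γ(S(G), A, m)` with `A` the subdividing vertices. -/
abbrev GammaVert {α : Type*} (G : SimpleGraph α) (m : ℕ) :=
  (α ⊕ G.edgeSet) ⊕
    Σ u : subdividers G, Fin (((subdivision G).neighborSet (u : α ⊕ G.edgeSet)).ncard * (m - 1))

/-- `Γ = ⋃_{i} Γ(S(G), A, n i)` with `A` the subdividing vertices of `S(G)`. -/
def bigGamma {α : Type*} (G : SimpleGraph α) {k : ℕ} (n : Fin k → ℕ) :
    SimpleGraph (Σ i : Fin k, GammaVert G (n i)) :=
  sigmaGraph fun i => Gamma (subdivision G) (subdividers G) (n i)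

/-- The set `A_{u,i}` inside `Γ`: the copy of `u` in `Γ_i` together with all its clones. -/
def cloneSet {α : Type*} (G : SimpleGraph α) {k : ℕ} (n : Fin k → ℕ)
    (u : subdividers G) (i : Fin k) : Set (Σ i : Fin k, GammaVert G (n i)) :=
  {p | p = ⟨i, Sum.inl (u : α ⊕ G.edgeSet)⟩ ∨
    ∃ j : Fin (((subdivision G).neighborSet (u : α ⊕ G.edgeSet)).ncard * (n i - 1)),
      p = ⟨i, Sum.inr ⟨u, j⟩⟩}
namespace SimpleGraph

variable {α : Type*} {G : SimpleGraph α}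

/-- A homomorphism covers its target if it hits every vertex and every edge. -/
def Covers {β : Type*} {H : SimpleGraph β} (f : G →g H) : Prop :=
  Function.Surjective f ∧ ∀ ⦃u v⦄, H.Adj u v → ∃ x y, G.Adj x y ∧ f x = u ∧ f y = v

theorem selfEmbeddable_iff :
    SelfEmbeddable G ↔ ∃ f : G →g G, Function.Injective f ∧ ¬ Covers f := by
  constructor
  · rintro ⟨G', hG', ⟨φ⟩⟩
    refine ⟨G'.hom.comp φ.toHom, Subtype.val_injective.comp φ.injective, fun hf => hG' ?_⟩
    have hadj : ∀ {u v}, G.Adj u v → G'.Adj u v := by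
      intro u v huv
      obtain ⟨x, y, hxy, rfl, rfl⟩ := hf.2 huv
      exact φ.map_adj_iff.2 hxy
    ext u v
    · refine iff_of_true ?_ trivial
      obtain ⟨x, rfl⟩ := hf.1 u
      exact (φ x).2
    · exact ⟨fun h => G'.adj_sub h, hadj⟩
  · rintro ⟨f, hf, hcov⟩
    refine ⟨(⊤ : G.Subgraph).map f, fun htop => hcov ⟨fun u => ?_, fun u v huv => ?_⟩, ⟨?_⟩⟩
    · have hu : u ∈ ((⊤ : G.Subgraph).map f).verts := by rw [htop]; trivial
      obtain ⟨x, -, hx⟩ := hu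
      exact ⟨x, hx⟩
    · have h : ((⊤ : G.Subgraph).map f).Adj u v := by rw [htop]; exact huv
      obtain ⟨x, y, hxy, hx, hy⟩ := h
      exact ⟨x, y, hxy, hx, hy⟩
    · refine ⟨Equiv.ofBijective (fun x => ⟨f x, x, trivial, rfl⟩) ⟨fun x y hxy => ?_, ?_⟩, ?_⟩
      · exact hf (congrArg Subtype.val hxy)
      · rintro ⟨_, x, -, rfl⟩
        exact ⟨x, rfl⟩
      · intro x y
        constructor
        · rintro ⟨a, b, hab, ha, hb⟩
          rw [← hf ha, ← hf hb]
          exact hab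
        · exact fun h => ⟨x, y, h, rfl, rfl⟩

/-- An injective endomorphism of a connected graph in which every vertex has exactly two
neighbors covers the graph. -/
theorem Connected.covers_of_two_neighbors (hG : G.Connected)
    (htwo : ∀ x, ∃ a b, a ≠ b ∧ G.Adj x a ∧ G.Adj x b)
    (hle : ∀ x a b c, G.Adj x a → G.Adj x b → G.Adj x c → a = b ∨ a = c ∨ b = c)
    {f : G →g G} (hf : Function.Injective f) : Covers f := by
  have hlift : ∀ x y, G.Adj (f x) y → ∃ x', G.Adj x x' ∧ f x' = y := by
    intro x y hy
    obtain ⟨a, b, hab, ha, hb⟩ := htwo x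
    rcases hle _ _ _ _ (f.map_adj ha) (f.map_adj hb) hy with h | h | h
    · exact absurd (hf h) hab
    · exact ⟨a, ha, h⟩
    · exact ⟨b, hb, h⟩
  have hsurj : Function.Surjective f := by
    intro u
    obtain ⟨x₀⟩ := hG.nonempty
    obtain ⟨p⟩ := hG.preconnected (f x₀) u
    suffices h : ∀ {a b} (_ : G.Walk a b), (∃ x, f x = a) → ∃ x, f x = b from h p ⟨x₀, rfl⟩
    intro a b p
    induction p with
    | nil => exact id
    | cons hadj _ ih =>
      rintro ⟨x, rfl⟩
      obtain ⟨x', -, hx'⟩ := hlift x _ hadj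
      exact ih ⟨x', hx'⟩
  refine ⟨hsurj, fun u v huv => ?_⟩
  obtain ⟨x, rfl⟩ := hsurj u
  obtain ⟨y, hxy, rfl⟩ := hlift x v huv
  exact ⟨x, y, hxy, rfl, rfl⟩

@[simp]
theorem subdivision_adj_inl_inr {v : α} {e : G.edgeSet} :
    (subdivision G).Adj (.inl v) (.inr e) ↔ v ∈ (e : Sym2 α) := by
  simp [subdivision]

@[simp]
theorem subdivision_adj_inr_inl {v : α} {e : G.edgeSet} :
    (subdivision G).Adj (.inr e) (.inl v) ↔ v ∈ (e : Sym2 α) := by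
  simp [subdivision]

@[simp]
theorem not_subdivision_adj_inl_inl {v w : α} :
    ¬ (subdivision G).Adj (.inl v) (.inl w) := by
  simp [subdivision]

@[simp]
theorem not_subdivision_adj_inr_inr {e e' : G.edgeSet} :
    ¬ (subdivision G).Adj (.inr e) (.inr e') := by
  simp [subdivision]

theorem exists_of_subdivision_adj_inl {v : α} {x : α ⊕ G.edgeSet}
    (h : (subdivision G).Adj (.inl v) x) : ∃ e : G.edgeSet, x = .inr e ∧ v ∈ (e : Sym2 α) := by
  rcases x with w | e
  · simp at h
  · exact ⟨e, rfl, by simpa using h⟩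

theorem exists_of_subdivision_adj_inr {e : G.edgeSet} {x : α ⊕ G.edgeSet}
    (h : (subdivision G).Adj (.inr e) x) : ∃ v, x = .inl v ∧ v ∈ (e : Sym2 α) := by
  rcases x with v | e'
  · exact ⟨v, rfl, by simpa using h⟩
  · simp at h

theorem edgeSet_eq_of_mem {v w : α} (hvw : v ≠ w) {e e' : G.edgeSet}
    (hv : v ∈ (e : Sym2 α)) (hw : w ∈ (e : Sym2 α))
    (hv' : v ∈ (e' : Sym2 α)) (hw' : w ∈ (e' : Sym2 α)) : e = e' :=
  Subtype.ext <|
    ((Sym2.mem_and_mem_iff hvw).1 ⟨hv, hw⟩).trans ((Sym2.mem_and_mem_iff hvw).1 ⟨hv', hw'⟩).symm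

theorem Connected.subdivision (hG : G.Connected) : (subdivision G).Connected := by
  have hinl : ∀ v w, (_root_.subdivision G).Reachable (.inl v) (.inl w) := by
    intro v w
    obtain ⟨p⟩ := hG.preconnected v w
    induction p with
    | nil => rfl
    | @cons u v w h _ ih =>
      have h₁ : (_root_.subdivision G).Adj (.inl u) (.inr ⟨s(u, v), h⟩) := by simp
      have h₂ : (_root_.subdivision G).Adj (.inr ⟨s(u, v), h⟩) (.inl v) := by simp
      exact h₁.reachable.trans (h₂.reachable.trans ih)
  have hinr : ∀ x, ∃ v, (_root_.subdivision G).Reachable x (.inl v) := by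
    rintro (v | ⟨e, he⟩)
    · exact ⟨v, .rfl⟩
    · induction e with
      | _ a b =>
        have h : (_root_.subdivision G).Adj (.inr ⟨s(a, b), he⟩) (.inl a) := by simp
        exact ⟨a, h.reachable⟩
  obtain ⟨v₀⟩ := hG.nonempty
  refine @Connected.mk _ _ (fun x y => ?_) ⟨.inl v₀⟩
  obtain ⟨v, hv⟩ := hinr x
  obtain ⟨w, hw⟩ := hinr y
  exact hv.trans ((hinl v w).trans hw.symm)

theorem subdivision_inr_two_neighbors (e : G.edgeSet) :
    ∃ a b, a ≠ b ∧ (subdivision G).Adj (.inr e) a ∧ (subdivision G).Adj (.inr e) b := by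
  obtain ⟨e, he⟩ := e
  induction e with
  | _ a b => exact ⟨.inl a, .inl b, by simpa using G.ne_of_adj he, by simp, by simp⟩

theorem subdivision_inr_neighbors_le_two (e : G.edgeSet) (a b c : α ⊕ G.edgeSet)
    (ha : (subdivision G).Adj (.inr e) a) (hb : (subdivision G).Adj (.inr e) b)
    (hc : (subdivision G).Adj (.inr e) c) : a = b ∨ a = c ∨ b = c := by
  obtain ⟨a, rfl, -⟩ := exists_of_subdivision_adj_inr ha
  obtain ⟨b, rfl, -⟩ := exists_of_subdivision_adj_inr hb
  obtain ⟨c, rfl, -⟩ := exists_of_subdivision_adj_inr hc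
  obtain ⟨e, he⟩ := e
  induction e with
  | _ x y =>
    have ha : a = x ∨ a = y := Sym2.mem_iff.1 (subdivision_adj_inr_inl.1 ha)
    have hb : b = x ∨ b = y := Sym2.mem_iff.1 (subdivision_adj_inr_inl.1 hb)
    have hc : c = x ∨ c = y := Sym2.mem_iff.1 (subdivision_adj_inr_inl.1 hc)
    grind

theorem leafless_subdivision (hG : Leafless G) : Leafless (subdivision G) := by
  rintro (v | e) ⟨x, hx, hu⟩
  · obtain ⟨⟨e, he⟩, rfl, hv⟩ := exists_of_subdivision_adj_inl hx
    obtain ⟨w, rfl⟩ := Sym2.mem_iff_exists.1 hv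
    refine hG v ⟨w, he, fun w' hw' => ?_⟩
    have h := hu (.inr ⟨s(v, w'), hw'⟩) (by simp)
    exact Sym2.congr_right.1 (congrArg Subtype.val (Sum.inr_injective h))
  · obtain ⟨a, b, hab, ha, hb⟩ := subdivision_inr_two_neighbors e
    exact hab ((hu a ha).trans (hu b hb).symm)

theorem not_embeds_cycle4_subdivision : ¬ Embeds cycle4 (subdivision G) := by
  rintro ⟨f, hf, hadj⟩
  have h₀₁ := @hadj 0 1 (by simp [cycle4]; decide)
  have h₂₁ := @hadj 2 1 (by simp [cycle4]; decide)
  have h₀₃ := @hadj 0 3 (by simp [cycle4]; decide)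
  have h₂₃ := @hadj 2 3 (by simp [cycle4]; decide)
  have hne₀₂ : f 0 ≠ f 2 := hf.ne (by decide)
  have hne₁₃ : f 1 ≠ f 3 := hf.ne (by decide)
  rcases h0 : f 0 with v | e <;> rcases h1 : f 1 with v' | e' <;>
    rcases h2 : f 2 with w | d <;> rcases h3 : f 3 with w' | d' <;>
    simp only [h0, h1, h2, h3, subdivision_adj_inl_inr, subdivision_adj_inr_inl,
      not_subdivision_adj_inl_inl, not_subdivision_adj_inr_inr, ne_eq, Sum.inl.injEq,
      Sum.inr.injEq] at h₀₁ h₂₁ h₀₃ h₂₃ hne₀₂ hne₁₃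
  · exact hne₁₃ (edgeSet_eq_of_mem hne₀₂ h₀₁ h₂₁ h₀₃ h₂₃)
  · exact hne₀₂ (edgeSet_eq_of_mem hne₁₃ h₀₁ h₀₃ h₂₁ h₂₃)

/-- If an injective endomorphism of `S(G)` sends original vertices to original vertices, it is
induced by an injective endomorphism of `G`. -/
theorem covers_of_forall_inl (hG : ¬ SelfEmbeddable G)
    {f : subdivision G →g subdivision G} (hf : Function.Injective f)
    (hinl : ∀ v, ∃ w, f (.inl v) = .inl w) : Covers f := by
  choose g hg using hinl
  have hginj : Function.Injective g := fun v w h =>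
    Sum.inl_injective (hf (by rw [hg, hg, h]))
  have hedge : ∀ {v w} (h : G.Adj v w), ∃ h' : G.Adj (g v) (g w),
      f (.inr ⟨s(v, w), h⟩) = .inr ⟨s(g v, g w), h'⟩ := by
    intro v w h
    have hv : (subdivision G).Adj (f (.inl v)) (f (.inr ⟨s(v, w), h⟩)) := f.map_adj (by simp)
    have hw : (subdivision G).Adj (f (.inl w)) (f (.inr ⟨s(v, w), h⟩)) := f.map_adj (by simp)
    rw [hg] at hv hw
    obtain ⟨⟨e, he⟩, hfe, hve⟩ := exists_of_subdivision_adj_inl hv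
    rw [hfe, subdivision_adj_inl_inr] at hw
    obtain rfl := (Sym2.mem_and_mem_iff (hginj.ne h.ne)).1 ⟨hve, hw⟩
    exact ⟨he, hfe⟩
  have hcov : Covers (⟨g, fun h => (hedge h).1⟩ : G →g G) := by
    by_contra h
    exact hG (selfEmbeddable_iff.2 ⟨_, hginj, h⟩)
  have hlift : ∀ {v} {e : G.edgeSet}, v ∈ (e : Sym2 α) → ∃ x y,
      (subdivision G).Adj x y ∧ f x = .inl v ∧ f y = .inr e := by
    rintro v ⟨e, he⟩ hv
    obtain ⟨w, rfl⟩ := Sym2.mem_iff_exists.1 hv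
    obtain ⟨x, y, hxy, rfl, rfl⟩ := hcov.2 he
    exact ⟨.inl x, .inr ⟨s(x, y), hxy⟩, by simp, hg x, (hedge hxy).2⟩
  refine ⟨?_, ?_⟩
  · rintro (v | e)
    · obtain ⟨x, rfl⟩ := hcov.1 v
      exact ⟨.inl x, hg x⟩
    · obtain ⟨_, y, -, -, hy⟩ := hlift (e : Sym2 α).out_fst_mem
      exact ⟨y, hy⟩
  · rintro (v | e) (w | d) h
    · simp at h
    · exact hlift (by simpa using h)
    · obtain ⟨x, y, hxy, hx, hy⟩ := hlift (subdivision_adj_inr_inl.1 h)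
      exact ⟨y, x, hxy.symm, hy, hx⟩
    · simp at h

theorem Connected.not_selfEmbeddable_subdivision (hGc : G.Connected) (hGl : Leafless G)
    (hGs : ¬ SelfEmbeddable G) : ¬ SelfEmbeddable (_root_.subdivision G) := by
  rw [selfEmbeddable_iff]
  rintro ⟨f, hf, hcov⟩
  have hstep : ∀ {v w}, G.Adj v w → (∃ e, f (.inl v) = .inr e) → ∃ e, f (.inl w) = .inr e := by
    rintro v w h ⟨e, he⟩
    have hv : (_root_.subdivision G).Adj (f (.inl v)) (f (.inr ⟨s(v, w), h⟩)) :=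
      f.map_adj (by simp)
    have hw : (_root_.subdivision G).Adj (f (.inr ⟨s(v, w), h⟩)) (f (.inl w)) :=
      f.map_adj (by simp)
    rw [he] at hv
    obtain ⟨u, hu, -⟩ := exists_of_subdivision_adj_inr hv
    rw [hu] at hw
    obtain ⟨d, hd, -⟩ := exists_of_subdivision_adj_inl hw
    exact ⟨d, hd⟩
  by_cases hinl : ∀ v, ∃ w, f (.inl v) = .inl w
  · exact hcov (covers_of_forall_inl hGs hf hinl)
  push Not at hinl
  obtain ⟨v₀, hv₀⟩ := hinl
  obtain ⟨e₀, he₀⟩ : ∃ e, f (.inl v₀) = .inr e := by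
    rcases h : f (.inl v₀) with w | e
    · exact absurd h (hv₀ w)
    · exact ⟨e, rfl⟩
  have hinr : ∀ v, ∃ e, f (.inl v) = .inr e := by
    intro v
    obtain ⟨p⟩ := hGc.preconnected v₀ v
    suffices h : ∀ {a b} (_ : G.Walk a b), (∃ e, f (.inl a) = .inr e) →
        ∃ e, f (.inl b) = .inr e from h p ⟨e₀, he₀⟩
    intro a b p
    induction p with
    | nil => exact id
    | cons hadj _ ih => exact fun h => ih (hstep hadj h)
  have hSc := hGc.subdivision
  have : Nontrivial (α ⊕ G.edgeSet) := ⟨.inl v₀, .inr e₀, by simp⟩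
  refine hcov (hSc.covers_of_two_neighbors (fun x => ?_) (fun x a b c ha hb hc => ?_) hf)
  · obtain ⟨a, ha⟩ := hSc.preconnected.exists_adj_of_nontrivial x
    by_contra! h
    exact leafless_subdivision hGl x ⟨a, ha, fun b hb => by_contra fun hne => h b a hne hb ha⟩
  · rcases x with v | e
    · obtain ⟨e, he⟩ := hinr v
      have hle := subdivision_inr_neighbors_le_two e (f a) (f b) (f c)
        (he ▸ f.map_adj ha) (he ▸ f.map_adj hb) (he ▸ f.map_adj hc)
      simpa only [hf.eq_iff] using hle
    · exact subdivision_inr_neighbors_le_two e a b c ha hb hc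

end SimpleGraph

/-- Proposition 7: if `G` is connected, leafless and non–self-embeddable, then so is its
subdivision graph `S(G)`; moreover `S(G)` is `C₄`-free. -/
theorem stmt_17 {α : Type u} (G : SimpleGraph α)
    (hGc : G.Connected) (hGl : Leafless G) (hGs : ¬ SelfEmbeddable G) :
    (subdivision G).Connected ∧ Leafless (subdivision G) ∧
      ¬ SelfEmbeddable (subdivision G) ∧ ¬ Embeds cycle4 (subdivision G) := by
  exact ⟨hGc.subdivision, leafless_subdivision hGl,
    hGc.not_selfEmbeddable_subdivision hGl hGs, not_embeds_cycle4_subdivision⟩
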